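/- Let m and n be positive integers with n ≤ m, and let C be an m×n Cauchon diagram such that the kernel of M(C) over ℚ has dimension e ≥ 1. Then there exists a white box b of C such that C' = C ∪ {b} is again an m×n Cauchon diagram and the kernel of M(C') over ℚ has dimension e − 1. -/

import Mathlib

/-- An `m × n` Cauchon diagram: a set of black boxes such that every black box
has either all boxes strictly to its left black or all boxes strictly above it black. -/
def IsCauchonDiagram {m n : ℕ} (C : Finset (Fin m × Fin n)) : Prop :=
  ∀ p ∈ C, (∀ j' : Fin n, j' < p.2 → (p.1, j') ∈ C) ∨ (∀ i' : Fin m, i' < p.1 → (i', p.2) ∈ C)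

/-- The entry of the skew-adjacency matrix corresponding to a pair of boxes. -/
def cauchonEntry {m n : ℕ} (p q : Fin m × Fin n) : ℚ :=
  if (p.1 = q.1 ∧ p.2 < q.2) ∨ (p.2 = q.2 ∧ p.1 < q.1) then 1
  else if (p.1 = q.1 ∧ q.2 < p.2) ∨ (p.2 = q.2 ∧ q.1 < p.1) then -1
  else 0

/-- The skew-adjacency matrix `M(C)` of a Cauchon diagram, indexed by the white boxes. -/
def cauchonMatrix {m n : ℕ} (C : Finset (Fin m × Fin n)) :
    Matrix {p : Fin m × Fin n // p ∉ C} {p : Fin m × Fin n // p ∉ C} ℚ :=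
  fun p q => cauchonEntry p.1 q.1

/-- The dimension over `ℚ` of the kernel of `M(C)`. -/
noncomputable def kerDim {m n : ℕ} (C : Finset (Fin m × Fin n)) : ℕ :=
  Module.finrank ℚ (LinearMap.ker (Matrix.mulVecLin (cauchonMatrix C)))

/-- The sign of `y - x`: `1` if `x < y`, `-1` if `y < x`, and `0` if `x = y`. -/
def orderSign {k : ℕ} (x y : Fin k) : ℚ :=
  if x < y then 1 else if y < x then -1 else 0

lemma cauchonEntry_eq {m n : ℕ} (p q : Fin m × Fin n) :
    cauchonEntry p q = (if p.1 = q.1 then orderSign p.2 q.2 else 0) +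
      (if p.2 = q.2 then orderSign p.1 q.1 else 0) := by
  obtain ⟨i, j⟩ := p
  obtain ⟨k, l⟩ := q
  simp only [cauchonEntry, orderSign]
  grind

lemma cauchonEntry_swap {m n : ℕ} (p q : Fin m × Fin n) :
    cauchonEntry q p = -cauchonEntry p q := by
  obtain ⟨i, j⟩ := p
  obtain ⟨k, l⟩ := q
  simp only [cauchonEntry]
  grind

lemma sum_cauchonEntry_mul {m n : ℕ} (i : Fin m) (j : Fin n) (v : Fin m × Fin n → ℚ) :
    ∑ q, cauchonEntry (i, j) q * v q =
      ∑ j', orderSign j j' * v (i, j') + ∑ i', orderSign i i' * v (i', j) := by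
  simp only [cauchonEntry_eq, add_mul, Finset.sum_add_distrib]
  congr 1
  · rw [Fintype.sum_prod_type, Finset.sum_eq_single i] <;> simp +contextual [eq_comm]
  · rw [Fintype.sum_prod_type_right, Finset.sum_eq_single j] <;> simp +contextual [eq_comm]

lemma sum_orderSign_mul_of_eq_zero_of_lt {k : ℕ} (x : Fin k) (f : Fin k → ℚ)
    (h : ∀ y < x, f y = 0) : ∑ y, orderSign x y * f y = ∑ y, f y - f x := by
  have hx : ∑ y, (if y = x then f y else 0) = f x := by simp
  rw [eq_sub_iff_add_eq, ← hx, ← Finset.sum_add_distrib]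
  refine Finset.sum_congr rfl fun y _ => ?_
  rcases lt_trichotomy x y with hxy | rfl | hxy
  · simp [orderSign, hxy, hxy.ne']
  · simp [orderSign]
  · simp [h y hxy]

lemma sum_orderSign_mul_of_eq_zero_of_gt {k : ℕ} (x : Fin k) (f : Fin k → ℚ)
    (h : ∀ y, x < y → f y = 0) : ∑ y, orderSign x y * f y = f x - ∑ y, f y := by
  have hx : ∑ y, (if y = x then f y else 0) = f x := by simp
  rw [eq_sub_iff_add_eq, ← hx, ← Finset.sum_add_distrib]
  refine Finset.sum_congr rfl fun y _ => ?_
  rcases lt_trichotomy x y with hxy | rfl | hxy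
  · simp [h y hxy]
  · simp [orderSign]
  · simp [orderSign, hxy, hxy.ne, hxy.not_gt]

/-- A vector with `∑ y, orderSign x y * f y = f x` on its support vanishes. -/
lemma eq_zero_of_sum_orderSign_mul_eq {k : ℕ} (f : Fin k → ℚ)
    (h : ∀ x, f x ≠ 0 → ∑ y, orderSign x y * f y = f x) : f = 0 := by
  classical
  by_contra hf
  have hs : (Finset.univ.filter fun x => f x ≠ 0).Nonempty := by
    obtain ⟨x, hx⟩ := Function.ne_iff.mp hf
    exact ⟨x, by simpa using hx⟩
  obtain ⟨a, ha, hamin⟩ := Finset.exists_minimal hs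
  obtain ⟨b, hb, hbmax⟩ := Finset.exists_maximal hs
  simp only [Finset.mem_filter, Finset.mem_univ, true_and] at ha hamin hb hbmax
  have h₁ := sum_orderSign_mul_of_eq_zero_of_lt a f fun y hy => by
    by_contra hne
    exact (hamin hne hy.le).not_gt hy
  have h₂ := sum_orderSign_mul_of_eq_zero_of_gt b f fun y hy => by
    by_contra hne
    exact (hbmax hne hy.le).not_gt hy
  rw [h a ha] at h₁
  rw [h b hb] at h₂
  exact ha (by linarith)

/-- The kernel of `M(C)`, realized as a space of functions on all boxes that vanish on `C`. -/
def extendedKer {m n : ℕ} (C : Finset (Fin m × Fin n)) : Submodule ℚ (Fin m × Fin n → ℚ) where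
  carrier := {v | (∀ p ∈ C, v p = 0) ∧ ∀ p ∉ C, ∑ q, cauchonEntry p q * v q = 0}
  add_mem' {v w} hv hw :=
    ⟨fun p hp => by simp [hv.1 p hp, hw.1 p hp], fun p hp => by
      simp [mul_add, Finset.sum_add_distrib, hv.2 p hp, hw.2 p hp]⟩
  zero_mem' := by simp
  smul_mem' c v hv :=
    ⟨fun p hp => by simp [hv.1 p hp], fun p hp => by
      simp [mul_left_comm, ← Finset.mul_sum, hv.2 p hp]⟩

lemma mem_extendedKer {m n : ℕ} {C : Finset (Fin m × Fin n)} {v : Fin m × Fin n → ℚ} :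
    v ∈ extendedKer C ↔
      (∀ p ∈ C, v p = 0) ∧ ∀ p ∉ C, ∑ q, cauchonEntry p q * v q = 0 :=
  Iff.rfl

lemma cauchonMatrix_mulVec_apply {m n : ℕ} {C : Finset (Fin m × Fin n)}
    {v : Fin m × Fin n → ℚ} (hv : ∀ p ∈ C, v p = 0) (p : {p : Fin m × Fin n // p ∉ C}) :
    (cauchonMatrix C).mulVec (fun q => v q) p = ∑ q, cauchonEntry p.1 q * v q := by
  classical
  rw [← Finset.sum_subset (Finset.subset_univ (Finset.univ.filter (· ∉ C)))
    fun q _ hq => by simp [hv q (by simpa using hq)]]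
  exact (Finset.sum_subtype (Finset.univ.filter (· ∉ C)) (by simp)
    fun q => cauchonEntry p.1 q * v q).symm

/-- Restriction to the white boxes identifies `extendedKer C` with the kernel of `M(C)`. -/
def extendedKerEquiv {m n : ℕ} (C : Finset (Fin m × Fin n)) :
    extendedKer C ≃ₗ[ℚ] LinearMap.ker (Matrix.mulVecLin (cauchonMatrix C)) where
  toFun v := ⟨fun q => v.1 q, by
    rw [LinearMap.mem_ker, Matrix.mulVecLin_apply]
    funext p
    rw [cauchonMatrix_mulVec_apply v.2.1, v.2.2 p.1 p.2, Pi.zero_apply]⟩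
  map_add' _ _ := rfl
  map_smul' _ _ := rfl
  invFun w := ⟨fun q => if h : q ∉ C then w.1 ⟨q, h⟩ else 0, by
    have hz : ∀ p ∈ C, (fun q => if h : q ∉ C then w.1 ⟨q, h⟩ else 0) p = 0 :=
      fun p hp => by simp [hp]
    refine ⟨hz, fun p hp => ?_⟩
    rw [← cauchonMatrix_mulVec_apply hz ⟨p, hp⟩]
    have hw := congrFun (LinearMap.mem_ker.mp w.2) ⟨p, hp⟩
    rw [Matrix.mulVecLin_apply] at hw
    have hres : (fun q : {p // p ∉ C} => if h : q.1 ∉ C then w.1 ⟨q.1, h⟩ else 0) = w.1 :=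
      funext fun q => dif_pos q.2
    exact (congrArg (fun u => (cauchonMatrix C).mulVec u ⟨p, hp⟩) hres).trans hw⟩
  left_inv v := by
    ext q
    by_cases hq : q ∈ C
    · simp [hq, v.2.1 q hq]
    · simp [hq]
  right_inv w := by
    ext q
    simp [q.2]

lemma kerDim_eq_finrank_extendedKer {m n : ℕ} (C : Finset (Fin m × Fin n)) :
    kerDim C = Module.finrank ℚ (extendedKer C) :=
  (extendedKerEquiv C).finrank_eq.symm

/-- A kernel vector that vanishes at the topmost white box of every column is zero. -/
lemma eq_zero_of_mem_extendedKer {m n : ℕ} {C : Finset (Fin m × Fin n)}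
    {v : Fin m × Fin n → ℚ} (hv : v ∈ extendedKer C)
    (h : ∀ i j, (i, j) ∉ C → (∀ i' < i, (i', j) ∈ C) → v (i, j) = 0) : v = 0 := by
  classical
  suffices hrow : ∀ i : Fin m, (fun j => v (i, j)) = 0 from
    funext fun p => congrFun (hrow p.1) p.2
  intro i
  induction i using WellFoundedLT.induction with
  | ind i ih =>
  have ih' : ∀ i' < i, ∀ j, v (i', j) = 0 := fun i' hi' j => congrFun (ih i' hi') j
  refine eq_zero_of_sum_orderSign_mul_eq _ fun j hij => ?_
  have hwhite : (i, j) ∉ C := fun hC => hij (hv.1 _ hC)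
  obtain ⟨k, hk, hkmin⟩ := Finset.exists_minimal
    (s := Finset.univ.filter fun k => (k, j) ∉ C) ⟨i, by simpa using hwhite⟩
  simp only [Finset.mem_filter, Finset.mem_univ, true_and] at hk hkmin
  have hfirst : ∀ i' < k, (i', j) ∈ C := fun i' hi' => by
    by_contra hne
    exact (hkmin hne hi'.le).not_gt hi'
  have hvk : v (k, j) = 0 := h k j hk hfirst
  have hki : k < i := by
    refine lt_of_not_ge fun hik => ?_
    rcases hik.lt_or_eq with hlt | rfl
    · exact hwhite (hfirst i hlt)
    · exact hij hvk
  have hcol := hv.2 (k, j) hk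
  rw [sum_cauchonEntry_mul,
    sum_orderSign_mul_of_eq_zero_of_lt k (fun i' => v (i', j))
      fun y hy => hv.1 _ (hfirst y hy)] at hcol
  simp only [ih' k hki, mul_zero, Finset.sum_const_zero] at hcol
  have heq := hv.2 (i, j) hwhite
  rw [sum_cauchonEntry_mul,
    sum_orderSign_mul_of_eq_zero_of_lt i (fun i' => v (i', j)) fun y hy => ih' y hy j] at heq
  linarith

/-- Blackening a white box in the support of a kernel vector cuts the kernel down to the vectors
vanishing there. -/
lemma mem_extendedKer_insert {m n : ℕ} {C : Finset (Fin m × Fin n)} {b : Fin m × Fin n}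
    (hb : b ∉ C) {v : Fin m × Fin n → ℚ} (hv : v ∈ extendedKer C) (hvb : v b ≠ 0)
    {w : Fin m × Fin n → ℚ} :
    w ∈ extendedKer (insert b C) ↔ w ∈ extendedKer C ∧ w b = 0 := by
  simp only [mem_extendedKer, Finset.mem_insert, not_or, forall_eq_or_imp]
  refine ⟨fun ⟨⟨hwb, hwC⟩, hw⟩ => ⟨⟨hwC, fun p hp => ?_⟩, hwb⟩,
    fun ⟨⟨hwC, hw⟩, hwb⟩ => ⟨⟨hwb, hwC⟩, fun p hp => hw p hp.2⟩⟩
  by_cases hpb : p = b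
  · subst hpb
    have hskew : ∑ r, v r * ∑ q, cauchonEntry r q * w q =
        -∑ q, w q * ∑ r, cauchonEntry q r * v r := by
      simp only [Finset.mul_sum]
      rw [Finset.sum_comm, ← Finset.sum_neg_distrib]
      refine Finset.sum_congr rfl fun q _ => ?_
      rw [← Finset.sum_neg_distrib]
      refine Finset.sum_congr rfl fun r _ => ?_
      rw [cauchonEntry_swap q r]
      ring
    have hright : ∑ q, w q * ∑ r, cauchonEntry q r * v r = 0 := by
      refine Finset.sum_eq_zero fun q _ => ?_
      by_cases hq : q ∈ C
      · rw [hwC q hq, zero_mul]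
      · rw [hv.2 q hq, mul_zero]
    rw [hright, neg_zero, Finset.sum_eq_single p] at hskew
    · exact (mul_eq_zero.mp hskew).resolve_left hvb
    · intro q _ hqp
      by_cases hq : q ∈ C
      · rw [hv.1 q hq, zero_mul]
      · rw [hw q ⟨hqp, hq⟩, mul_zero]
    · simp
  · exact hw p ⟨hpb, hp⟩

lemma kerDim_insert_add_one {m n : ℕ} {C : Finset (Fin m × Fin n)} {b : Fin m × Fin n}
    (hb : b ∉ C) {v : Fin m × Fin n → ℚ} (hv : v ∈ extendedKer C) (hvb : v b ≠ 0) :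
    kerDim (insert b C) + 1 = kerDim C := by
  let f : Module.Dual ℚ (extendedKer C) := (LinearMap.proj b).domRestrict (extendedKer C)
  have hf : f ≠ 0 := fun h0 => hvb (LinearMap.congr_fun h0 ⟨v, hv⟩)
  have hmap : (LinearMap.ker f).map (extendedKer C).subtype = extendedKer (insert b C) := by
    ext w
    rw [mem_extendedKer_insert hb hv hvb]
    simp [f, and_comm]
  rw [kerDim_eq_finrank_extendedKer, kerDim_eq_finrank_extendedKer, ← hmap,
    Submodule.finrank_map_subtype_eq]
  exact Module.Dual.finrank_ker_add_one_of_ne_zero hf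

lemma IsCauchonDiagram.insert {m n : ℕ} {C : Finset (Fin m × Fin n)} (hC : IsCauchonDiagram C)
    {i : Fin m} {j : Fin n} (h : ∀ i' < i, (i', j) ∈ C) :
    IsCauchonDiagram (insert (i, j) C) := by
  intro p hp
  rcases Finset.mem_insert.mp hp with rfl | hp
  · exact Or.inr fun i' hi' => Finset.mem_insert_of_mem (h i' hi')
  · exact (hC p hp).imp (fun H j' hj' => Finset.mem_insert_of_mem (H j' hj'))
      fun H i' hi' => Finset.mem_insert_of_mem (H i' hi')

/-- Proposition 4.9: if ker M(C) has dimension e ≥ 1, one can blacken a single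
white box of C, staying a Cauchon diagram, so that the kernel dimension drops to e − 1. -/
theorem exists_insert_kerDim_pred (m n : ℕ) (hm : 0 < m) (hn : 0 < n) (hnm : n ≤ m)
    (C : Finset (Fin m × Fin n)) (hC : IsCauchonDiagram C)
    (e : ℕ) (he1 : 1 ≤ e) (he : kerDim C = e) :
    ∃ b : Fin m × Fin n, b ∉ C ∧ IsCauchonDiagram (insert b C) ∧
      kerDim (insert b C) = e - 1 := by
  have hne : extendedKer C ≠ ⊥ := fun hbot => by
    rw [kerDim_eq_finrank_extendedKer, hbot, finrank_bot] at he
    omega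
  obtain ⟨v, hv, hv0⟩ := Submodule.exists_mem_ne_zero_of_ne_bot hne
  have hex : ∃ i j, (i, j) ∉ C ∧ (∀ i' < i, (i', j) ∈ C) ∧ v (i, j) ≠ 0 := by
    by_contra! hcon
    exact hv0 (eq_zero_of_mem_extendedKer hv hcon)
  obtain ⟨i, j, hb, hfirst, hvb⟩ := hex
  have hdim := kerDim_insert_add_one hb hv hvb
  exact ⟨(i, j), hb, hC.insert hfirst, by omega⟩
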